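/- arXiv:1903.03690 — 4 statements merged into one kernel-verified Lean document; each statement's English description precedes it below -/
import Mathlib

section
/- Under the exclusion restrictions of the instrumental-variable model, the efficient influence curve for the restricted model has variance no larger than that for the unrestricted model: E_P[(D_{Y,r} + D_Z + D_W)²] ≤ E_P[(D_Y + D_Z + D_W)²]. -/
open MeasureTheory

noncomputable section

/-- Discrete transported-mediation setup: a probability space `(Ω, P)` carrying
binary random variables `S, A, Z, M`, a covariate `W` valued in a nonempty finite
set `𝒲`, and an outcome `Y` valued in a nonempty finite set `ySet ⊆ ℝ`, with
strong positivity of every joint cell. -/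
structure TransportSetup (Ω : Type*) [MeasurableSpace Ω]
    (𝒲 : Type*) [MeasurableSpace 𝒲] [MeasurableSingletonClass 𝒲]
    [Fintype 𝒲] [Nonempty 𝒲] where
  P : Measure Ω
  isProb : IsProbabilityMeasure P
  S : Ω → Fin 2
  A : Ω → Fin 2
  Z : Ω → Fin 2
  M : Ω → Fin 2
  W : Ω → 𝒲
  Y : Ω → ℝ
  ySet : Finset ℝ
  ySet_nonempty : ySet.Nonempty
  hY : ∀ ω, Y ω ∈ ySet
  measS : Measurable S
  measA : Measurable A
  measZ : Measurable Z
  measM : Measurable M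
  measW : Measurable W
  measY : Measurable Y
  positivity : ∀ (s' x z m : Fin 2) (w : 𝒲), ∀ y ∈ ySet,
    0 < P {ω | S ω = s' ∧ W ω = w ∧ A ω = x ∧ Z ω = z ∧ M ω = m ∧ Y ω = y}

namespace TransportSetup

variable {Ω : Type*} [MeasurableSpace Ω]
  {𝒲 : Type*} [MeasurableSpace 𝒲] [MeasurableSingletonClass 𝒲]
  [Fintype 𝒲] [Nonempty 𝒲]
variable (T : TransportSetup Ω 𝒲)

/-- Probability of an event, as a real number. -/
def pr (E : Set Ω) : ℝ := (T.P E).toReal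

/-- Conditional probability `P(E | F)`. -/
def cpr (E F : Set Ω) : ℝ := T.pr (E ∩ F) / T.pr F

/-- Conditional expectation `E[f | F]` of a real random variable given an event. -/
def cexp (f : Ω → ℝ) (F : Set Ω) : ℝ := (∫ ω in F, f ω ∂T.P) / T.pr F

/-- `Q̄_Y(m,z,x,w) = E[Y | M=m, Z=z, A=x, W=w, S=1]`. -/
def qbarY (m z x : Fin 2) (w : 𝒲) : ℝ :=
  T.cexp T.Y {ω | T.M ω = m ∧ T.Z ω = z ∧ T.A ω = x ∧ T.W ω = w ∧ T.S ω = 1}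

/-- `P(Z=z | A=x, W=w, S=s)`. -/
def pZ (x z : Fin 2) (w : 𝒲) (s : Fin 2) : ℝ :=
  T.cpr {ω | T.Z ω = z} {ω | T.A ω = x ∧ T.W ω = w ∧ T.S ω = s}

/-- `P(S=s | W=w)`. -/
def pSW (s : Fin 2) (w : 𝒲) : ℝ := T.cpr {ω | T.S ω = s} {ω | T.W ω = w}

/-- `P(M=m | Z=z, A=x, W=w, S=1)`. -/
def pM (m z x : Fin 2) (w : 𝒲) : ℝ :=
  T.cpr {ω | T.M ω = m} {ω | T.Z ω = z ∧ T.A ω = x ∧ T.W ω = w ∧ T.S ω = 1}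

/-- `P(A=x | W=w, S=s)`. -/
def pA (x : Fin 2) (w : 𝒲) (s : Fin 2) : ℝ :=
  T.cpr {ω | T.A ω = x} {ω | T.W ω = w ∧ T.S ω = s}

/-- `P(S=0)`. -/
def pS0 : ℝ := T.pr {ω | T.S ω = 0}

/-- `P(W=w | S=0)`. -/
def pWS0 (w : 𝒲) : ℝ := T.cpr {ω | T.W ω = w} {ω | T.S ω = 0}

/-- The transported estimand `Ψ(P)`. -/
def Psi (gs : Fin 2 → 𝒲 → ℝ) (a : Fin 2) : ℝ :=
  ∑ w : 𝒲, ∑ z : Fin 2, ∑ m : Fin 2,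
    T.pWS0 w * T.pZ a z w 0 * gs m w * T.qbarY m z a w

/-- The transport-mediation weight `H`. -/
def Hwt (gs : Fin 2 → 𝒲 → ℝ) (a : Fin 2) (ω : Ω) : ℝ :=
  (gs (T.M ω) (T.W ω) * T.pZ a (T.Z ω) (T.W ω) 0 * T.pSW 0 (T.W ω) *
    (if T.S ω = 1 ∧ T.A ω = a then (1 : ℝ) else 0)) /
  (T.pM (T.M ω) (T.Z ω) a (T.W ω) * T.pZ a (T.Z ω) (T.W ω) 1 * T.pA a (T.W ω) 1 *
    T.pSW 1 (T.W ω) * T.pS0)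

/-- `Q̄_M(z,x,w) = Σ_m g*(m|w) Q̄_Y(m,z,x,w)`. -/
def qbarM (gs : Fin 2 → 𝒲 → ℝ) (z x : Fin 2) (w : 𝒲) : ℝ :=
  ∑ m : Fin 2, gs m w * T.qbarY m z x w

/-- `Q̄_Z(w) = Σ_z P(Z=z|A=a,W=w,S=0) Q̄_M(z,a,w)`. -/
def qbarZ (gs : Fin 2 → 𝒲 → ℝ) (a : Fin 2) (w : 𝒲) : ℝ :=
  ∑ z : Fin 2, T.pZ a z w 0 * T.qbarM gs z a w

/-- `D_Y`, the `Y`-component of the (unrestricted-model) efficient influence curve. -/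
def DY (gs : Fin 2 → 𝒲 → ℝ) (a : Fin 2) (ω : Ω) : ℝ :=
  (T.Y ω - T.qbarY (T.M ω) (T.Z ω) (T.A ω) (T.W ω)) * T.Hwt gs a ω

/-- `D_Z`, the `Z`-component of the efficient influence curve. -/
def DZ (gs : Fin 2 → 𝒲 → ℝ) (a : Fin 2) (ω : Ω) : ℝ :=
  (T.qbarM gs (T.Z ω) a (T.W ω) - T.qbarZ gs a (T.W ω)) *
    (if T.S ω = 0 ∧ T.A ω = a then (1 : ℝ) else 0) / (T.pA a (T.W ω) 0 * T.pS0)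

/-- `D_W`, the `W`-component of the efficient influence curve. -/
def DW (gs : Fin 2 → 𝒲 → ℝ) (a : Fin 2) (ω : Ω) : ℝ :=
  (T.qbarZ gs a (T.W ω) - T.Psi gs a) *
    (if T.S ω = 0 then (1 : ℝ) else 0) / T.pS0


end TransportSetup

namespace TransportSetup

variable {Ω : Type*} [MeasurableSpace Ω]
  {𝒲 : Type*} [MeasurableSpace 𝒲] [MeasurableSingletonClass 𝒲]
  [Fintype 𝒲] [Nonempty 𝒲]
variable (T : TransportSetup Ω 𝒲)

/-- `Q̄_{Y,r}(m,z,w) = E[Y | M=m, Z=z, W=w]` (restricted model). -/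
def qbarYr (m z : Fin 2) (w : 𝒲) : ℝ :=
  T.cexp T.Y {ω | T.M ω = m ∧ T.Z ω = z ∧ T.W ω = w}

/-- `P(M=m | Z=z, W=w, S=1)` (restricted model). -/
def pMr (m z : Fin 2) (w : 𝒲) : ℝ :=
  T.cpr {ω | T.M ω = m} {ω | T.Z ω = z ∧ T.W ω = w ∧ T.S ω = 1}

/-- `P(Z=z | W=w, S=1) = Σ_x P(Z=z | A=x, W=w, S=1) · P(A=x | W=w, S=1)`. -/
def pZr (z : Fin 2) (w : 𝒲) : ℝ :=
  ∑ x : Fin 2, T.pZ x z w 1 * T.pA x w 1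

/-- `D_{Y,r}`, the `Y`-component of the efficient influence curve for the
restricted model in which `M` and `Y` do not depend directly on `A`. -/
def DYr (gs : Fin 2 → 𝒲 → ℝ) (a : Fin 2) (ω : Ω) : ℝ :=
  (T.Y ω - T.qbarYr (T.M ω) (T.Z ω) (T.W ω)) *
    ((gs (T.M ω) (T.W ω) * T.pZ a (T.Z ω) (T.W ω) 0 * T.pSW 0 (T.W ω) *
      (if T.S ω = 1 then (1 : ℝ) else 0)) /
    (T.pMr (T.M ω) (T.Z ω) (T.W ω) * T.pZr (T.Z ω) (T.W ω) *
      T.pSW 1 (T.W ω) * T.pS0))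

end TransportSetup

namespace TransportSetup

variable {Ω : Type*} [MeasurableSpace Ω]
  {𝒲 : Type*} [MeasurableSpace 𝒲] [MeasurableSingletonClass 𝒲]
  [Fintype 𝒲] [Nonempty 𝒲]
variable (T : TransportSetup Ω 𝒲)

lemma integrable_factor (g : Fin 2 → Fin 2 → Fin 2 → Fin 2 → 𝒲 → ℝ → ℝ) :
    Integrable (fun ω => g (T.S ω) (T.A ω) (T.Z ω) (T.M ω) (T.W ω) (T.Y ω)) T.P := by
  haveI := T.isProb
  let X : Ω → Fin 2 × Fin 2 × Fin 2 × Fin 2 × 𝒲 × T.ySet :=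
    fun ω => (T.S ω, T.A ω, T.Z ω, T.M ω, T.W ω, ⟨T.Y ω, T.hY ω⟩)
  have hX : Measurable X :=
    T.measS.prodMk (T.measA.prodMk (T.measZ.prodMk (T.measM.prodMk (T.measW.prodMk
      (T.measY.subtype_mk)))))
  let G : Fin 2 × Fin 2 × Fin 2 × Fin 2 × 𝒲 × T.ySet → ℝ :=
    fun p => g p.1 p.2.1 p.2.2.1 p.2.2.2.1 p.2.2.2.2.1 p.2.2.2.2.2
  haveI : IsFiniteMeasure (T.P.map X) := inferInstance
  have hG : Integrable G (T.P.map X) := Integrable.of_finite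
  exact hG.comp_measurable hX

lemma integral_split {ι : Type*} [Fintype ι] [MeasurableSpace ι] [MeasurableSingletonClass ι]
    (X : Ω → ι) (hX : Measurable X) {F : Set Ω} (hF : MeasurableSet F) {f : Ω → ℝ}
    (hf : Integrable f T.P) :
    ∫ ω in F, f ω ∂T.P = ∑ i, ∫ ω in F ∩ {ω | X ω = i}, f ω ∂T.P := by
  rw [← integral_iUnion_fintype]
  · congr 2
    ext ω
    simp
  · intro i
    exact hF.inter (hX (measurableSet_singleton i))
  · intro i j hij
    refine Set.disjoint_left.2 ?_
    rintro ω ⟨_, h1⟩ ⟨_, h2⟩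
    exact hij (h1.symm.trans h2)
  · intro i
    exact hf.integrableOn

lemma setInt_one (F : Set Ω) : ∫ _ in F, (1 : ℝ) ∂T.P = T.pr F := by
  simp [pr, Measure.real]

lemma pr_split {ι : Type*} [Fintype ι] [MeasurableSpace ι] [MeasurableSingletonClass ι]
    (X : Ω → ι) (hX : Measurable X) {F : Set Ω} (hF : MeasurableSet F) :
    T.pr F = ∑ i, T.pr (F ∩ {ω | X ω = i}) := by
  haveI := T.isProb
  simp only [← setInt_one]
  exact T.integral_split X hX hF (integrable_const _)

/-- Full discrete cell. -/
def cell (m z x : Fin 2) (w : 𝒲) (s : Fin 2) : Set Ω :=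
  {ω | T.M ω = m ∧ T.Z ω = z ∧ T.A ω = x ∧ T.W ω = w ∧ T.S ω = s}

lemma meas_eq {ι : Type*} [MeasurableSpace ι] [MeasurableSingletonClass ι]
    {X : Ω → ι} (hX : Measurable X) (i : ι) : MeasurableSet {ω | X ω = i} :=
  hX (measurableSet_singleton i)

lemma meas_cell (m z x : Fin 2) (w : 𝒲) (s : Fin 2) : MeasurableSet (T.cell m z x w s) :=
  (meas_eq T.measM m).inter ((meas_eq T.measZ z).inter ((meas_eq T.measA x).inter
    ((meas_eq T.measW w).inter (meas_eq T.measS s))))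

lemma pr_mono {E F : Set Ω} (h : E ⊆ F) : T.pr E ≤ T.pr F := by
  haveI := T.isProb
  exact ENNReal.toReal_mono (measure_ne_top _ _) (measure_mono h)

lemma cell_pos (m z x : Fin 2) (w : 𝒲) (s : Fin 2) : 0 < T.pr (T.cell m z x w s) := by
  haveI := T.isProb
  obtain ⟨y, hy⟩ := T.ySet_nonempty
  have h := ENNReal.toReal_pos (T.positivity s x z m w y hy).ne' (measure_ne_top _ _)
  refine lt_of_lt_of_le h (T.pr_mono ?_)
  rintro ω ⟨h1, h2, h3, h4, h5, h6⟩
  exact ⟨h5, h4, h3, h2, h1⟩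

lemma pr_pos_of {F : Set Ω} (m z x : Fin 2) (w : 𝒲) (s : Fin 2) (h : T.cell m z x w s ⊆ F) :
    0 < T.pr F := (T.cell_pos m z x w s).trans_le (T.pr_mono h)

lemma int_Y {F : Set Ω} (f : ℝ → ℝ) :
    ∫ ω in F, f (T.Y ω) ∂T.P = ∑ y ∈ T.ySet, f y * T.pr ({ω | T.Y ω = y} ∩ F) := by
  haveI := T.isProb
  have h : ∀ ω, f (T.Y ω) = ∑ y ∈ T.ySet, ({ω | T.Y ω = y}).indicator (fun _ => f y) ω := by
    intro ω
    rw [Finset.sum_eq_single (T.Y ω)]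
    · simp
    · intro y _ hne
      simp [hne.symm]
    · intro h
      exact absurd (T.hY ω) h
  simp_rw [h]
  rw [integral_finset_sum]
  · refine Finset.sum_congr rfl fun y _ => ?_
    rw [setIntegral_indicator (meas_eq T.measY y), Set.inter_comm]
    simp [pr, Measure.real, mul_comm]
  · intro y _
    exact ((integrable_const _).indicator (meas_eq T.measY y))

lemma integral_cells {f : Ω → ℝ} (hf : Integrable f T.P) :
    ∫ ω, f ω ∂T.P = ∑ i : Fin 2 × Fin 2 × 𝒲, ∑ j : Fin 2 × Fin 2,
      ∫ ω in T.cell i.1 i.2.1 j.1 i.2.2 j.2, f ω ∂T.P := by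
  rw [← setIntegral_univ, T.integral_split (fun ω => (T.M ω, T.Z ω, T.W ω))
    (T.measM.prodMk (T.measZ.prodMk T.measW)) MeasurableSet.univ hf]
  refine Finset.sum_congr rfl fun i _ => ?_
  rw [T.integral_split (fun ω => (T.A ω, T.S ω)) (T.measA.prodMk T.measS)
    (MeasurableSet.univ.inter (meas_eq (T.measM.prodMk (T.measZ.prodMk T.measW)) i)) hf]
  refine Finset.sum_congr rfl fun j _ => ?_
  congr 2
  ext ω
  obtain ⟨m, z, w⟩ := i
  obtain ⟨x, s⟩ := j
  simp [cell]
  tauto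

section excl

variable (hYexcl : ∀ (m z x x' s' s'' : Fin 2) (w : 𝒲) (y : ℝ), y ∈ T.ySet →
      T.cpr {ω | T.Y ω = y} {ω | T.M ω = m ∧ T.Z ω = z ∧ T.A ω = x ∧ T.W ω = w ∧ T.S ω = s'} =
      T.cpr {ω | T.Y ω = y} {ω | T.M ω = m ∧ T.Z ω = z ∧ T.A ω = x' ∧ T.W ω = w ∧ T.S ω = s''})

/-- Common conditional law of `Y`. -/
def cY (m z : Fin 2) (w : 𝒲) (y : ℝ) : ℝ := T.cpr {ω | T.Y ω = y} (T.cell m z 0 w 1)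

/-- Common conditional mean of `Y`. -/
def mY (m z : Fin 2) (w : 𝒲) : ℝ := ∑ y ∈ T.ySet, y * T.cY m z w y

include hYexcl in
lemma int_cell (f : ℝ → ℝ) (m z x : Fin 2) (w : 𝒲) (s : Fin 2) :
    ∫ ω in T.cell m z x w s, f (T.Y ω) ∂T.P =
      T.pr (T.cell m z x w s) * ∑ y ∈ T.ySet, f y * T.cY m z w y := by
  rw [int_Y, Finset.mul_sum]
  refine Finset.sum_congr rfl fun y hy => ?_
  have h : T.cY m z w y = T.cpr {ω | T.Y ω = y} (T.cell m z x w s) := hYexcl m z 0 x 1 s w y hy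
  have h0 := (T.cell_pos m z x w s).ne'
  rw [h, cpr]
  field_simp

include hYexcl in
lemma qbarY_eq (m z x : Fin 2) (w : 𝒲) : T.qbarY m z x w = T.mY m z w := by
  have h := T.int_cell hYexcl (fun y => y) m z x w 1
  have h0 := (T.cell_pos m z x w 1).ne'
  change (∫ ω in T.cell m z x w 1, T.Y ω ∂T.P) / T.pr (T.cell m z x w 1) = _
  rw [h, mul_div_cancel_left₀ _ h0, mY]

include hYexcl in
lemma qbarYr_eq (m z : Fin 2) (w : 𝒲) : T.qbarYr m z w = T.mY m z w := by
  have hC : MeasurableSet {ω | T.M ω = m ∧ T.Z ω = z ∧ T.W ω = w} :=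
    (meas_eq T.measM m).inter ((meas_eq T.measZ z).inter (meas_eq T.measW w))
  have hs : ∀ j : Fin 2 × Fin 2, {ω | T.M ω = m ∧ T.Z ω = z ∧ T.W ω = w} ∩
      {ω | (T.A ω, T.S ω) = j} = T.cell m z j.1 w j.2 := by
    rintro ⟨x, s⟩
    ext ω
    simp [cell]
    tauto
  have hY : Integrable T.Y T.P := T.integrable_factor (fun _ _ _ _ _ y => y)
  have h1 := T.integral_split (fun ω => (T.A ω, T.S ω)) (T.measA.prodMk T.measS) hC hY
  have h2 := T.pr_split (fun ω => (T.A ω, T.S ω)) (T.measA.prodMk T.measS) hC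
  simp only [hs] at h1 h2
  have h3 : ∀ j : Fin 2 × Fin 2, ∫ ω in T.cell m z j.1 w j.2, T.Y ω ∂T.P =
      T.pr (T.cell m z j.1 w j.2) * T.mY m z w :=
    fun j => T.int_cell hYexcl (fun y => y) m z j.1 w j.2
  simp only [h3] at h1
  rw [← Finset.sum_mul, ← h2] at h1
  have h0 : 0 < T.pr {ω | T.M ω = m ∧ T.Z ω = z ∧ T.W ω = w} :=
    T.pr_pos_of m z 0 w 0 (fun ω h => ⟨h.1, h.2.1, h.2.2.2.1⟩)
  rw [qbarYr, cexp, h1, mul_div_cancel_left₀ _ h0.ne']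

end excl

lemma den_eq (m z a : Fin 2) (w : 𝒲) :
    T.pM m z a w * T.pZ a z w 1 * T.pA a w 1 * T.pSW 1 w =
      T.pr (T.cell m z a w 1) / T.pr {ω | T.W ω = w} := by
  have h1 : 0 < T.pr {ω | T.Z ω = z ∧ T.A ω = a ∧ T.W ω = w ∧ T.S ω = 1} :=
    T.pr_pos_of m z a w 1 (fun ω h => h.2)
  have h2 : 0 < T.pr {ω | T.A ω = a ∧ T.W ω = w ∧ T.S ω = 1} :=
    T.pr_pos_of m z a w 1 (fun ω h => h.2.2)
  have h3 : 0 < T.pr {ω | T.W ω = w ∧ T.S ω = 1} :=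
    T.pr_pos_of m z a w 1 (fun ω h => h.2.2.2)
  have e1 : {ω | T.M ω = m} ∩ {ω | T.Z ω = z ∧ T.A ω = a ∧ T.W ω = w ∧ T.S ω = 1} =
    T.cell m z a w 1 := rfl
  have e2 : {ω | T.Z ω = z} ∩ {ω | T.A ω = a ∧ T.W ω = w ∧ T.S ω = 1} =
    {ω | T.Z ω = z ∧ T.A ω = a ∧ T.W ω = w ∧ T.S ω = 1} := rfl
  have e3 : {ω | T.A ω = a} ∩ {ω | T.W ω = w ∧ T.S ω = 1} =
    {ω | T.A ω = a ∧ T.W ω = w ∧ T.S ω = 1} := rfl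
  have e4 : {ω | T.S ω = 1} ∩ {ω | T.W ω = w} = {ω | T.W ω = w ∧ T.S ω = 1} :=
    Set.inter_comm _ _
  simp only [pM, pZ, pA, pSW, cpr, e1, e2, e3, e4]
  field_simp

lemma denr_eq (m z : Fin 2) (w : 𝒲) :
    T.pMr m z w * T.pZr z w * T.pSW 1 w =
      (∑ x, T.pr (T.cell m z x w 1)) / T.pr {ω | T.W ω = w} := by
  have h1 : 0 < T.pr {ω | T.Z ω = z ∧ T.W ω = w ∧ T.S ω = 1} :=
    T.pr_pos_of m z 0 w 1 (fun ω h => ⟨h.2.1, h.2.2.2⟩)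
  have h2 : ∀ x, 0 < T.pr {ω | T.A ω = x ∧ T.W ω = w ∧ T.S ω = 1} :=
    fun x => T.pr_pos_of m z x w 1 (fun ω h => h.2.2)
  have h3 : 0 < T.pr {ω | T.W ω = w ∧ T.S ω = 1} :=
    T.pr_pos_of m z 0 w 1 (fun ω h => h.2.2.2)
  have mWS : MeasurableSet {ω | T.W ω = w ∧ T.S ω = 1} :=
    (meas_eq T.measW w).inter (meas_eq T.measS 1)
  have s1 := T.pr_split T.A T.measA ((meas_eq T.measM m).inter ((meas_eq T.measZ z).inter mWS))
  have s2 := T.pr_split T.A T.measA ((meas_eq T.measZ z).inter mWS)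
  have e1 : ∀ x, {ω | T.M ω = m} ∩ ({ω | T.Z ω = z} ∩ {ω | T.W ω = w ∧ T.S ω = 1}) ∩
      {ω | T.A ω = x} = T.cell m z x w 1 := by
    intro x
    ext ω
    simp [cell]
    tauto
  have e2 : ∀ x, {ω | T.Z ω = z} ∩ {ω | T.W ω = w ∧ T.S ω = 1} ∩ {ω | T.A ω = x} =
      {ω | T.Z ω = z} ∩ {ω | T.A ω = x ∧ T.W ω = w ∧ T.S ω = 1} := by
    intro x
    ext ω
    simp
    tauto
  simp only [e1] at s1
  simp only [e2] at s2
  have hz : T.pZr z w = T.pr {ω | T.Z ω = z ∧ T.W ω = w ∧ T.S ω = 1} /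
      T.pr {ω | T.W ω = w ∧ T.S ω = 1} := by
    change _ = T.pr ({ω | T.Z ω = z} ∩ {ω | T.W ω = w ∧ T.S ω = 1}) / _
    rw [s2, pZr, Finset.sum_div]
    refine Finset.sum_congr rfl fun x _ => ?_
    have e3 : {ω | T.A ω = x} ∩ {ω | T.W ω = w ∧ T.S ω = 1} =
      {ω | T.A ω = x ∧ T.W ω = w ∧ T.S ω = 1} := rfl
    have := (h2 x).ne'
    simp only [pZ, pA, cpr, e3]
    field_simp
  have e4 : {ω | T.S ω = 1} ∩ {ω | T.W ω = w} = {ω | T.W ω = w ∧ T.S ω = 1} :=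
    Set.inter_comm _ _
  have e5 : {ω | T.M ω = m} ∩ {ω | T.Z ω = z ∧ T.W ω = w ∧ T.S ω = 1} =
    {ω | T.M ω = m} ∩ ({ω | T.Z ω = z} ∩ {ω | T.W ω = w ∧ T.S ω = 1}) := rfl
  rw [hz, ← s1]
  simp only [pMr, pSW, cpr, e4, e5]
  field_simp

end TransportSetup

/-- Under the exclusion restrictions of the instrumental-variable
model, the efficient influence curve for the restricted model has variance no larger
than that for the unrestricted model:
`E_P[(D_{Y,r} + D_Z + D_W)²] ≤ E_P[(D_Y + D_Z + D_W)²]`. -/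
theorem restricted_eic_variance_le_unrestricted
    {Ω : Type*} [MeasurableSpace Ω]
    {𝒲 : Type*} [MeasurableSpace 𝒲] [MeasurableSingletonClass 𝒲]
    [Fintype 𝒲] [Nonempty 𝒲]
    (T : TransportSetup Ω 𝒲) (a : Fin 2)
    (gs : Fin 2 → 𝒲 → ℝ)
    (hgs_pos : ∀ (m : Fin 2) (w : 𝒲), 0 < gs m w ∧ gs m w < 1)
    (hgs_sum : ∀ w : 𝒲, gs 0 w + gs 1 w = 1)
    -- exclusion restriction: `P(Y=y | M=m, Z=z, A=x, W=w, S=s')` does not depend on `x, s'`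
    (hYexcl : ∀ (m z x x' s' s'' : Fin 2) (w : 𝒲) (y : ℝ), y ∈ T.ySet →
      T.cpr {ω | T.Y ω = y} {ω | T.M ω = m ∧ T.Z ω = z ∧ T.A ω = x ∧ T.W ω = w ∧ T.S ω = s'} =
      T.cpr {ω | T.Y ω = y} {ω | T.M ω = m ∧ T.Z ω = z ∧ T.A ω = x' ∧ T.W ω = w ∧ T.S ω = s''})
    -- exclusion restriction: `P(M=m | Z=z, A=x, W=w, S=s')` does not depend on `x`
    (hMexcl : ∀ (m z x x' s' : Fin 2) (w : 𝒲),
      T.cpr {ω | T.M ω = m} {ω | T.Z ω = z ∧ T.A ω = x ∧ T.W ω = w ∧ T.S ω = s'} =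
      T.cpr {ω | T.M ω = m} {ω | T.Z ω = z ∧ T.A ω = x' ∧ T.W ω = w ∧ T.S ω = s'}) :
    (∫ ω, (T.DYr gs a ω + T.DZ gs a ω + T.DW gs a ω) ^ 2 ∂T.P) ≤
      (∫ ω, (T.DY gs a ω + T.DZ gs a ω + T.DW gs a ω) ^ 2 ∂T.P) := by
  have iYr : Integrable (fun ω => (T.DYr gs a ω) ^ 2) T.P := T.integrable_factor
    (fun s x z m w y => ((y - T.qbarYr m z w) *
    ((gs m w * T.pZ a z w 0 * T.pSW 0 w * (if s = 1 then (1 : ℝ) else 0)) /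
    (T.pMr m z w * T.pZr z w * T.pSW 1 w * T.pS0))) ^ 2)
  have iY : Integrable (fun ω => (T.DY gs a ω) ^ 2) T.P := T.integrable_factor
    (fun s x z m w y => ((y - T.qbarY m z x w) *
    ((gs m w * T.pZ a z w 0 * T.pSW 0 w * (if s = 1 ∧ x = a then (1 : ℝ) else 0)) /
    (T.pM m z a w * T.pZ a z w 1 * T.pA a w 1 * T.pSW 1 w * T.pS0))) ^ 2)
  have iZW : Integrable (fun ω => (T.DZ gs a ω + T.DW gs a ω) ^ 2) T.P := T.integrable_factor
    (fun s x z m w y => ((T.qbarM gs z a w - T.qbarZ gs a w) *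
    (if s = 0 ∧ x = a then (1 : ℝ) else 0) / (T.pA a w 0 * T.pS0) +
    (T.qbarZ gs a w - T.Psi gs a) * (if s = 0 then (1 : ℝ) else 0) / T.pS0) ^ 2)
  have eYr : ∀ ω, (T.DYr gs a ω + T.DZ gs a ω + T.DW gs a ω) ^ 2 =
      (T.DYr gs a ω) ^ 2 + (T.DZ gs a ω + T.DW gs a ω) ^ 2 := by
    intro ω
    by_cases h : T.S ω = 1
    · simp [TransportSetup.DZ, TransportSetup.DW, h]
    · simp [TransportSetup.DYr, h]
  have eY : ∀ ω, (T.DY gs a ω + T.DZ gs a ω + T.DW gs a ω) ^ 2 =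
      (T.DY gs a ω) ^ 2 + (T.DZ gs a ω + T.DW gs a ω) ^ 2 := by
    intro ω
    by_cases h : T.S ω = 1
    · simp [TransportSetup.DZ, TransportSetup.DW, h]
    · simp [TransportSetup.DY, TransportSetup.Hwt, h]
  simp_rw [eYr, eY]
  rw [integral_add iYr iZW, integral_add iY iZW]
  refine add_le_add ?_ le_rfl
  rw [T.integral_cells iYr, T.integral_cells iY]
  refine Finset.sum_le_sum ?_
  rintro ⟨m, z, w⟩ -
  simp only
  set K : ℝ := gs m w * T.pZ a z w 0 * T.pSW 0 w * T.pr {ω | T.W ω = w} / T.pS0 with hK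
  set R : ℝ := ∑ x, T.pr (T.cell m z x w 1) with hR
  set V : ℝ := ∑ y ∈ T.ySet, (y - T.mY m z w) ^ 2 * T.cY m z w y with hV
  have cYr : ∀ x s : Fin 2, ∫ ω in T.cell m z x w s, (T.DYr gs a ω) ^ 2 ∂T.P =
      if s = 1 then T.pr (T.cell m z x w s) * V * (K / R) ^ 2 else 0 := by
    intro x s
    have : ∀ ω ∈ T.cell m z x w s, (T.DYr gs a ω) ^ 2 =
        (T.Y ω - T.mY m z w) ^ 2 * (if s = 1 then (K / R) ^ 2 else 0) := by
      rintro ω ⟨h1, h2, h3, h4, h5⟩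
      rw [TransportSetup.DYr, h1, h2, h4, h5, T.qbarYr_eq hYexcl, T.denr_eq, mul_pow]
      congr 1
      split_ifs
      · rw [hK]
        congr 1
        simp only [div_eq_mul_inv, mul_inv, inv_inv]
        ring
      · simp
    rw [setIntegral_congr_fun (T.meas_cell m z x w s) this, integral_mul_const,
      T.int_cell hYexcl (fun y => (y - T.mY m z w) ^ 2)]
    split_ifs <;> simp [hV]
  have cY : ∀ x s : Fin 2, ∫ ω in T.cell m z x w s, (T.DY gs a ω) ^ 2 ∂T.P =
      if s = 1 ∧ x = a then T.pr (T.cell m z x w s) * V * (K / T.pr (T.cell m z a w 1)) ^ 2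
      else 0 := by
    intro x s
    have : ∀ ω ∈ T.cell m z x w s, (T.DY gs a ω) ^ 2 =
        (T.Y ω - T.mY m z w) ^ 2 *
          (if s = 1 ∧ x = a then (K / T.pr (T.cell m z a w 1)) ^ 2 else 0) := by
      rintro ω ⟨h1, h2, h3, h4, h5⟩
      rw [TransportSetup.DY, TransportSetup.Hwt, h1, h2, h3, h4, h5, T.qbarY_eq hYexcl,
        T.den_eq, mul_pow]
      congr 1
      split_ifs
      · rw [hK]
        congr 1
        simp only [div_eq_mul_inv, mul_inv, inv_inv]
        ring
      · simp
    rw [setIntegral_congr_fun (T.meas_cell m z x w s) this, integral_mul_const,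
      T.int_cell hYexcl (fun y => (y - T.mY m z w) ^ 2)]
    split_ifs <;> simp [hV]
  have hVn : 0 ≤ V := Finset.sum_nonneg fun y _ =>
    mul_nonneg (sq_nonneg _) (div_nonneg ENNReal.toReal_nonneg ENNReal.toReal_nonneg)
  have hq := T.cell_pos m z a w 1
  have hqR : T.pr (T.cell m z a w 1) ≤ R :=
    Finset.single_le_sum (f := fun x => T.pr (T.cell m z x w 1))
      (fun x _ => (T.cell_pos m z x w 1).le) (Finset.mem_univ a)
  have hR0 : 0 < R := hq.trans_le hqR
  have l : ∑ j : Fin 2 × Fin 2, ∫ ω in T.cell m z j.1 w j.2, (T.DYr gs a ω) ^ 2 ∂T.P =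
      V * K ^ 2 / R := by
    simp only [cYr]
    rw [Fintype.sum_prod_type]
    simp only [Finset.sum_ite_eq', Finset.mem_univ, if_true]
    rw [← Finset.sum_mul, ← Finset.sum_mul, ← hR]
    field_simp
  have r : ∑ j : Fin 2 × Fin 2, ∫ ω in T.cell m z j.1 w j.2, (T.DY gs a ω) ^ 2 ∂T.P =
      V * K ^ 2 / T.pr (T.cell m z a w 1) := by
    simp only [cY]
    rw [Fintype.sum_prod_type]
    simp only [ite_and, Finset.sum_ite_eq', Finset.mem_univ, if_true]
    field_simp
  rw [l, r]
  gcongr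
end
end

section
/- Let (X, ℬ) be a measurable space, P₀ and Pₙ probability measures on it, and H, Ĥ, Y : X → ℝ bounded measurable functions with ∫H dP₀ = 1 and ∫Ĥ dPₙ ≠ 0. Then the one-step-corrected IPTW estimator admits the exact second-order expansion: ∫ĤY dPₙ + (1/∫Ĥ dPₙ)·∫ Ĥ·(Y − ∫ĤY dPₙ) dP₀ − ∫HY dP₀ = ∫(Ĥ − H)·Y dP₀ + (∫ĤY dP₀ − ∫ĤY dPₙ)·(∫Ĥ dP₀ − ∫Ĥ dPₙ)/∫Ĥ dPₙ + (∫ĤY dP₀ / ∫Ĥ dPₙ)·∫(H − Ĥ) dP₀. -/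
open MeasureTheory

/-- For probability measures `P₀`, `Pₙ` on a measurable space and
bounded measurable `H, Ĥ, Y` with `∫ H dP₀ = 1` and `∫ Ĥ dPₙ ≠ 0`, the one-step
corrected IPTW estimator admits the exact second-order expansion:
`∫ĤY dPₙ + (1/∫Ĥ dPₙ)·∫ Ĥ·(Y − ∫ĤY dPₙ) dP₀ − ∫HY dP₀ =
∫(Ĥ − H)·Y dP₀ + (∫ĤY dP₀ − ∫ĤY dPₙ)·(∫Ĥ dP₀ − ∫Ĥ dPₙ)/∫Ĥ dPₙ +
(∫ĤY dP₀/∫Ĥ dPₙ)·∫(H − Ĥ) dP₀`. -/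
theorem iptw_one_step_second_order_expansion
    {X : Type*} [MeasurableSpace X]
    (P₀ Pₙ : Measure X) [IsProbabilityMeasure P₀] [IsProbabilityMeasure Pₙ]
    (H Hhat Y : X → ℝ)
    (hH_meas : Measurable H) (hHhat_meas : Measurable Hhat) (hY_meas : Measurable Y)
    (hH_bdd : ∃ C : ℝ, ∀ x, |H x| ≤ C)
    (hHhat_bdd : ∃ C : ℝ, ∀ x, |Hhat x| ≤ C)
    (hY_bdd : ∃ C : ℝ, ∀ x, |Y x| ≤ C)
    (hH_one : (∫ x, H x ∂P₀) = 1)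
    (hHhat_ne : (∫ x, Hhat x ∂Pₙ) ≠ 0) :
    (∫ x, Hhat x * Y x ∂Pₙ) +
      (1 / ∫ x, Hhat x ∂Pₙ) *
        (∫ x, Hhat x * (Y x - ∫ x', Hhat x' * Y x' ∂Pₙ) ∂P₀) -
      (∫ x, H x * Y x ∂P₀) =
    (∫ x, (Hhat x - H x) * Y x ∂P₀) +
      ((∫ x, Hhat x * Y x ∂P₀) - (∫ x, Hhat x * Y x ∂Pₙ)) *
        ((∫ x, Hhat x ∂P₀) - (∫ x, Hhat x ∂Pₙ)) / (∫ x, Hhat x ∂Pₙ) +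
      ((∫ x, Hhat x * Y x ∂P₀) / (∫ x, Hhat x ∂Pₙ)) *
        (∫ x, (H x - Hhat x) ∂P₀) := by
  obtain ⟨C1, h1⟩ := hH_bdd
  obtain ⟨C2, h2⟩ := hHhat_bdd
  obtain ⟨C3, h3⟩ := hY_bdd
  have iH : Integrable H P₀ :=
    Integrable.of_bound hH_meas.aestronglyMeasurable C1 (Filter.Eventually.of_forall h1)
  have iG : Integrable Hhat P₀ :=
    Integrable.of_bound hHhat_meas.aestronglyMeasurable C2 (Filter.Eventually.of_forall h2)
  have iHY : Integrable (fun x => H x * Y x) P₀ :=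
    iH.mul_bdd (c := C3) hY_meas.aestronglyMeasurable (Filter.Eventually.of_forall h3)
  have iGY : Integrable (fun x => Hhat x * Y x) P₀ :=
    iG.mul_bdd (c := C3) hY_meas.aestronglyMeasurable (Filter.Eventually.of_forall h3)
  generalize (∫ x, Hhat x * Y x ∂Pₙ) = a
  have e1 : (∫ x, Hhat x * (Y x - a) ∂P₀) = (∫ x, Hhat x * Y x ∂P₀) - (∫ x, Hhat x ∂P₀) * a := by
    simp_rw [mul_sub]
    rw [integral_sub iGY (iG.mul_const a), integral_mul_const]
  have e2 : (∫ x, (Hhat x - H x) * Y x ∂P₀)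
      = (∫ x, Hhat x * Y x ∂P₀) - (∫ x, H x * Y x ∂P₀) := by
    simp_rw [sub_mul]
    rw [integral_sub iGY iHY]
  rw [e1, e2, integral_sub iH iG, hH_one]
  field_simp
  ring
end

section
/- Double robustness in the nuisance weights: let Q̄ : {0,1}×{0,1}×{0,1}×𝒲 → ℝ be an arbitrary function (a possibly misspecified outcome regression). Define the plug-ins Q̄_M^pl(z,x,w) := Σ_{m∈{0,1}} g*(m|w)·Q̄(m,z,x,w), Q̄_Z^pl(w) := Σ_{z∈{0,1}} P(Z=z | A=a, W=w, S=0)·Q̄_M^pl(z,a,w), the plug-in estimand Ψ̄ := Σ_{w∈𝒲} P(W=w | S=0)·Q̄_Z^pl(w), and the plug-in influence function D̄ := (Y − Q̄(M,Z,A,W))·H + (Q̄_M^pl(Z,a,W) − Q̄_Z^pl(W))·1{S=0, A=a}/(P(A=a | W=W, S=0)·P(S=0)) + (Q̄_Z^pl(W) − Ψ̄)·1{S=0}/P(S=0), where H is the correctly specified transport-mediation weight and all conditional probabilities are the true ones under P. Then the one-step estimating-equation functional is exactly unbiased: Ψ̄ + E_P[D̄] = Ψ(P). -/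
open MeasureTheory

noncomputable section

theorem tm_fiber {Ω K : Type*} [MeasurableSpace Ω] [Fintype K] (P : Measure Ω)
    (X : Ω → K) (E : Set Ω) (u : Ω → ℝ) (c : K → ℝ) (hu : Integrable u P)
    (hm : ∀ k, MeasurableSet {ω | X ω = k ∧ ω ∈ E}) (f : Ω → ℝ)
    (hf1 : ∀ ω ∈ E, f ω = c (X ω) * u ω) (hf0 : ∀ ω, ω ∉ E → f ω = 0) :
    Integrable f P ∧ ∫ ω, f ω ∂P = ∑ k, c k * ∫ ω in {ω | X ω = k ∧ ω ∈ E}, u ω ∂P := by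
  classical
  have hf : f = fun ω => ∑ k, c k * Set.indicator {ω | X ω = k ∧ ω ∈ E} u ω := by
    funext ω
    by_cases h : ω ∈ E
    · rw [hf1 ω h]
      simp [Set.indicator_apply, h]
    · rw [hf0 ω h]
      simp [Set.indicator_apply, h]
  have hi : ∀ k ∈ Finset.univ,
      Integrable (fun ω => c k * Set.indicator {ω | X ω = k ∧ ω ∈ E} u ω) P :=
    fun k _ => (hu.indicator (hm k)).const_mul _
  rw [hf]
  refine ⟨integrable_finset_sum _ hi, ?_⟩
  rw [integral_finset_sum _ hi]
  refine Finset.sum_congr rfl fun k _ => ?_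
  rw [integral_const_mul, integral_indicator (hm k)]

namespace TransportSetup

variable {Ω : Type*} [MeasurableSpace Ω]
  {𝒲 : Type*} [MeasurableSpace 𝒲] [MeasurableSingletonClass 𝒲]
  [Fintype 𝒲] [Nonempty 𝒲]

theorem tm_pr_pos (T : TransportSetup Ω 𝒲) (s x z m : Fin 2) (w : 𝒲) (E : Set Ω)
    (h : ∀ ω, T.S ω = s → T.W ω = w → T.A ω = x → T.Z ω = z → T.M ω = m → ω ∈ E) :
    0 < T.pr E := by
  have := T.isProb
  obtain ⟨y, hy⟩ := T.ySet_nonempty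
  refine ENNReal.toReal_pos ?_ (measure_ne_top _ _)
  refine (lt_of_lt_of_le (T.positivity s x z m w y hy) (measure_mono ?_)).ne'
  rintro ω ⟨h1, h2, h3, h4, h5, -⟩
  exact h ω h1 h2 h3 h4 h5

theorem tm_intY (T : TransportSetup Ω 𝒲) : Integrable T.Y T.P := by
  have := T.isProb
  refine Integrable.of_bound T.measY.aestronglyMeasurable (∑ y ∈ T.ySet, |y|) ?_
  refine Filter.Eventually.of_forall fun ω => ?_
  exact Finset.single_le_sum (f := fun y : ℝ => |y|) (fun y _ => abs_nonneg y) (T.hY ω)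

theorem tm_int1 (T : TransportSetup Ω 𝒲) (E : Set Ω) :
    ∫ _ω in E, (1 : ℝ) ∂T.P = T.pr E := by
  simp [pr, Measure.real]

theorem tm_meas (T : TransportSetup Ω 𝒲) :
    (∀ s, MeasurableSet {ω | T.S ω = s}) ∧ (∀ s, MeasurableSet {ω | T.A ω = s}) ∧
    (∀ s, MeasurableSet {ω | T.Z ω = s}) ∧ (∀ s, MeasurableSet {ω | T.M ω = s}) ∧
    (∀ s, MeasurableSet {ω | T.W ω = s}) :=
  ⟨fun s => T.measS (measurableSet_singleton s), fun s => T.measA (measurableSet_singleton s),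
   fun s => T.measZ (measurableSet_singleton s), fun s => T.measM (measurableSet_singleton s),
   fun s => T.measW (measurableSet_singleton s)⟩

theorem tm_sumZ (T : TransportSetup Ω 𝒲) (a : Fin 2) (w : 𝒲) :
    T.pZ a 0 w 0 + T.pZ a 1 w 0 = 1 := by
  have := T.isProb
  obtain ⟨mS, mA, mZ, mM, mW⟩ := T.tm_meas
  have hp : 0 < T.pr {ω | T.A ω = a ∧ T.W ω = w ∧ T.S ω = 0} :=
    T.tm_pr_pos 0 a 0 0 w _ (fun ω h1 h2 h3 _ _ => ⟨h3, h2, h1⟩)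
  unfold pZ cpr
  rw [← add_div, div_eq_one_iff_eq hp.ne']
  unfold pr
  rw [← ENNReal.toReal_add (measure_ne_top _ _) (measure_ne_top _ _)]
  congr 1
  have : {ω | T.Z ω = 1} = {ω | T.Z ω = 0}ᶜ := by
    ext ω
    simp only [Set.mem_setOf_eq, Set.mem_compl_iff]
    omega
  rw [this, Set.inter_comm, Set.inter_comm _ᶜ, ← Set.sdiff_eq]
  exact measure_inter_add_diff _ (mZ 0)

/-- the weight telescopes -/
theorem tm_tele (T : TransportSetup Ω 𝒲) (m z a : Fin 2) (w : 𝒲) (g p : ℝ) :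
    (g * p * T.pSW 0 w) / (T.pM m z a w * T.pZ a z w 1 * T.pA a w 1 * T.pSW 1 w * T.pS0)
     * T.pr {ω | T.M ω = m ∧ T.Z ω = z ∧ T.A ω = a ∧ T.W ω = w ∧ T.S ω = 1}
     = T.pWS0 w * p * g := by
  unfold pSW pM pZ pA pS0 pWS0 cpr
  have e1 : {ω | T.M ω = m} ∩ {ω | T.Z ω = z ∧ T.A ω = a ∧ T.W ω = w ∧ T.S ω = 1} =
    {ω | T.M ω = m ∧ T.Z ω = z ∧ T.A ω = a ∧ T.W ω = w ∧ T.S ω = 1} := rfl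
  have e2 : {ω | T.Z ω = z} ∩ {ω | T.A ω = a ∧ T.W ω = w ∧ T.S ω = 1} =
    {ω | T.Z ω = z ∧ T.A ω = a ∧ T.W ω = w ∧ T.S ω = 1} := rfl
  have e3 : {ω | T.A ω = a} ∩ {ω | T.W ω = w ∧ T.S ω = 1} =
    {ω | T.A ω = a ∧ T.W ω = w ∧ T.S ω = 1} := rfl
  have e4 : {ω | T.S ω = 1} ∩ {ω | T.W ω = w} = {ω | T.W ω = w ∧ T.S ω = 1} :=
    Set.inter_comm _ _
  have e5 : {ω | T.S ω = 0} ∩ {ω | T.W ω = w} = {ω | T.W ω = w} ∩ {ω | T.S ω = 0} :=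
    Set.inter_comm _ _
  rw [e1, e2, e3, e4, e5]
  have p1 := T.tm_pr_pos 1 a z m w
    {ω | T.M ω = m ∧ T.Z ω = z ∧ T.A ω = a ∧ T.W ω = w ∧ T.S ω = 1}
    (fun ω h1 h2 h3 h4 h5 => ⟨h5, h4, h3, h2, h1⟩)
  have p2 := T.tm_pr_pos 1 a z m w
    {ω | T.Z ω = z ∧ T.A ω = a ∧ T.W ω = w ∧ T.S ω = 1}
    (fun ω h1 h2 h3 h4 h5 => ⟨h4, h3, h2, h1⟩)
  have p3 := T.tm_pr_pos 1 a z m w {ω | T.A ω = a ∧ T.W ω = w ∧ T.S ω = 1}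
    (fun ω h1 h2 h3 h4 h5 => ⟨h3, h2, h1⟩)
  have p4 := T.tm_pr_pos 1 a z m w {ω | T.W ω = w ∧ T.S ω = 1}
    (fun ω h1 h2 h3 h4 h5 => ⟨h2, h1⟩)
  have p5 := T.tm_pr_pos 1 a z m w {ω | T.W ω = w} (fun ω h1 h2 h3 h4 h5 => h2)
  have p6 := T.tm_pr_pos 0 a z m w {ω | T.S ω = 0} (fun ω h1 h2 h3 h4 h5 => h1)
  field_simp

theorem tm_tele2 (T : TransportSetup Ω 𝒲) (z a : Fin 2) (w : 𝒲) :
    T.pr {ω | T.Z ω = z ∧ T.A ω = a ∧ T.W ω = w ∧ T.S ω = 0} / (T.pA a w 0 * T.pS0)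
     = T.pWS0 w * T.pZ a z w 0 := by
  unfold pZ pA pS0 pWS0 cpr
  have e2 : {ω | T.Z ω = z} ∩ {ω | T.A ω = a ∧ T.W ω = w ∧ T.S ω = 0} =
    {ω | T.Z ω = z ∧ T.A ω = a ∧ T.W ω = w ∧ T.S ω = 0} := rfl
  have e3 : {ω | T.A ω = a} ∩ {ω | T.W ω = w ∧ T.S ω = 0} =
    {ω | T.A ω = a ∧ T.W ω = w ∧ T.S ω = 0} := rfl
  have e4 : {ω | T.W ω = w} ∩ {ω | T.S ω = 0} = {ω | T.W ω = w ∧ T.S ω = 0} := rfl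
  rw [e2, e3, e4]
  have p3 := T.tm_pr_pos 0 a z 0 w {ω | T.A ω = a ∧ T.W ω = w ∧ T.S ω = 0}
    (fun ω h1 h2 h3 h4 h5 => ⟨h3, h2, h1⟩)
  have p4 := T.tm_pr_pos 0 a z 0 w {ω | T.W ω = w ∧ T.S ω = 0}
    (fun ω h1 h2 h3 h4 h5 => ⟨h2, h1⟩)
  have p6 := T.tm_pr_pos 0 a z 0 w {ω | T.S ω = 0} (fun ω h1 h2 h3 h4 h5 => h1)
  field_simp

theorem tm_term1 (T : TransportSetup Ω 𝒲) (a : Fin 2) (gs : Fin 2 → 𝒲 → ℝ)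
    (Qb : Fin 2 → Fin 2 → Fin 2 → 𝒲 → ℝ) :
    Integrable (fun ω => (T.Y ω - Qb (T.M ω) (T.Z ω) (T.A ω) (T.W ω)) * T.Hwt gs a ω) T.P ∧
    ∫ ω, (T.Y ω - Qb (T.M ω) (T.Z ω) (T.A ω) (T.W ω)) * T.Hwt gs a ω ∂T.P =
      T.Psi gs a - ∑ w : 𝒲, ∑ z : Fin 2, ∑ m : Fin 2,
        T.pWS0 w * T.pZ a z w 0 * gs m w * Qb m z a w := by
  have := T.isProb
  obtain ⟨mS, mA, mZ, mM, mW⟩ := T.tm_meas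
  let X : Ω → 𝒲 × Fin 2 × Fin 2 := fun ω => (T.W ω, T.Z ω, T.M ω)
  let E : Set Ω := {ω | T.S ω = 1 ∧ T.A ω = a}
  let h : 𝒲 × Fin 2 × Fin 2 → ℝ := fun k =>
    (gs k.2.2 k.1 * T.pZ a k.2.1 k.1 0 * T.pSW 0 k.1) /
      (T.pM k.2.2 k.2.1 a k.1 * T.pZ a k.2.1 k.1 1 * T.pA a k.1 1 * T.pSW 1 k.1 * T.pS0)
  have hset : ∀ k : 𝒲 × Fin 2 × Fin 2, {ω | X ω = k ∧ ω ∈ E} =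
      {ω | T.M ω = k.2.2 ∧ T.Z ω = k.2.1 ∧ T.A ω = a ∧ T.W ω = k.1 ∧ T.S ω = 1} := by
    rintro ⟨w, z, m⟩
    ext ω
    simp only [X, E, Set.mem_setOf_eq, Prod.mk.injEq]
    tauto
  have hm : ∀ k, MeasurableSet {ω | X ω = k ∧ ω ∈ E} := by
    intro k
    rw [hset]
    exact (mM _).inter ((mZ _).inter ((mA _).inter ((mW _).inter (mS _))))
  obtain ⟨i1, j1⟩ := tm_fiber T.P X E T.Y h T.tm_intY hm (fun ω => T.Y ω * T.Hwt gs a ω)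
    (by
      rintro ω ⟨h1, h2⟩
      simp only [Hwt, h, X, h1, h2]
      simp
      ring)
    (by
      intro ω hω
      have hω' : ¬ (T.S ω = 1 ∧ T.A ω = a) := hω
      simp only [Hwt, if_neg hω']
      simp)
  obtain ⟨i2, j2⟩ := tm_fiber T.P X E (fun _ => (1 : ℝ))
    (fun k => Qb k.2.2 k.2.1 a k.1 * h k) (integrable_const _) hm
    (fun ω => Qb (T.M ω) (T.Z ω) (T.A ω) (T.W ω) * T.Hwt gs a ω)
    (by
      rintro ω ⟨h1, h2⟩
      simp only [Hwt, h, X, h1, h2]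
      simp)
    (by
      intro ω hω
      have hω' : ¬ (T.S ω = 1 ∧ T.A ω = a) := hω
      simp only [Hwt, if_neg hω']
      simp)
  simp only [sub_mul]
  refine ⟨i1.sub i2, ?_⟩
  rw [integral_sub i1 i2, j1, j2]
  simp only [hset, tm_int1, Fintype.sum_prod_type, Psi]
  congr 1
  · refine Finset.sum_congr rfl fun w _ => Finset.sum_congr rfl fun z _ =>
      Finset.sum_congr rfl fun m _ => ?_
    have p1 := T.tm_pr_pos 1 a z m w
      {ω | T.M ω = m ∧ T.Z ω = z ∧ T.A ω = a ∧ T.W ω = w ∧ T.S ω = 1}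
      (fun ω h1 h2 h3 h4 h5 => ⟨h5, h4, h3, h2, h1⟩)
    rw [← T.tm_tele m z a w (gs m w) (T.pZ a z w 0)]
    unfold qbarY cexp
    rw [mul_assoc, mul_div_cancel₀ _ p1.ne']
  · refine Finset.sum_congr rfl fun w _ => Finset.sum_congr rfl fun z _ =>
      Finset.sum_congr rfl fun m _ => ?_
    rw [← T.tm_tele m z a w (gs m w) (T.pZ a z w 0)]
    simp only [h]
    ring

theorem tm_term2 (T : TransportSetup Ω 𝒲) (a : Fin 2)
    (q : Fin 2 → 𝒲 → ℝ) (r : 𝒲 → ℝ) (hr : ∀ w, r w = ∑ z : Fin 2, T.pZ a z w 0 * q z w) :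
    Integrable (fun ω => (q (T.Z ω) (T.W ω) - r (T.W ω)) *
        (if T.S ω = 0 ∧ T.A ω = a then (1 : ℝ) else 0) / (T.pA a (T.W ω) 0 * T.pS0)) T.P ∧
    ∫ ω, (q (T.Z ω) (T.W ω) - r (T.W ω)) *
        (if T.S ω = 0 ∧ T.A ω = a then (1 : ℝ) else 0) / (T.pA a (T.W ω) 0 * T.pS0) ∂T.P = 0 := by
  have := T.isProb
  obtain ⟨mS, mA, mZ, mM, mW⟩ := T.tm_meas
  let X : Ω → 𝒲 × Fin 2 := fun ω => (T.W ω, T.Z ω)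
  let E : Set Ω := {ω | T.S ω = 0 ∧ T.A ω = a}
  have hset : ∀ k : 𝒲 × Fin 2, {ω | X ω = k ∧ ω ∈ E} =
      {ω | T.Z ω = k.2 ∧ T.A ω = a ∧ T.W ω = k.1 ∧ T.S ω = 0} := by
    rintro ⟨w, z⟩
    ext ω
    simp only [X, E, Set.mem_setOf_eq, Prod.mk.injEq]
    tauto
  have hm : ∀ k, MeasurableSet {ω | X ω = k ∧ ω ∈ E} := by
    intro k
    rw [hset]
    exact (mZ _).inter ((mA _).inter ((mW _).inter (mS _)))
  obtain ⟨i1, j1⟩ := tm_fiber T.P X E (fun _ => (1 : ℝ))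
    (fun k => (q k.2 k.1 - r k.1) / (T.pA a k.1 0 * T.pS0)) (integrable_const _) hm
    (fun ω => (q (T.Z ω) (T.W ω) - r (T.W ω)) *
        (if T.S ω = 0 ∧ T.A ω = a then (1 : ℝ) else 0) / (T.pA a (T.W ω) 0 * T.pS0))
    (by
      intro ω hω
      have hω' : T.S ω = 0 ∧ T.A ω = a := hω
      simp only [if_pos hω', X, mul_one])
    (by
      intro ω hω
      have hω' : ¬ (T.S ω = 0 ∧ T.A ω = a) := hω
      simp only [if_neg hω']
      simp)
  refine ⟨i1, ?_⟩
  rw [j1]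
  simp only [hset, tm_int1, Fintype.sum_prod_type]
  refine Finset.sum_eq_zero fun w _ => ?_
  simp only [div_mul_eq_mul_div, mul_div_assoc, tm_tele2, Fin.sum_univ_two]
  have h1 := T.tm_sumZ a w
  have h2 := hr w
  rw [Fin.sum_univ_two] at h2
  linear_combination (-T.pWS0 w) * h2 - T.pWS0 w * r w * h1

theorem tm_term3 (T : TransportSetup Ω 𝒲) (r : 𝒲 → ℝ) (c : ℝ)
    (hc : c = ∑ w, T.pWS0 w * r w) :
    Integrable (fun ω => (r (T.W ω) - c) * (if T.S ω = 0 then (1 : ℝ) else 0) / T.pS0) T.P ∧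
    ∫ ω, (r (T.W ω) - c) * (if T.S ω = 0 then (1 : ℝ) else 0) / T.pS0 ∂T.P = 0 := by
  have := T.isProb
  obtain ⟨mS, mA, mZ, mM, mW⟩ := T.tm_meas
  have hp : 0 < T.pS0 := T.tm_pr_pos 0 0 0 0 (Classical.arbitrary 𝒲) _ (fun ω h1 _ _ _ _ => h1)
  have hm : ∀ k, MeasurableSet {ω | T.W ω = k ∧ ω ∈ {ω | T.S ω = 0}} :=
    fun k => (mW k).inter (mS 0)
  have key : ∀ c' : 𝒲 → ℝ,
      Integrable (fun ω => c' (T.W ω) * (if T.S ω = 0 then (1 : ℝ) else 0) / T.pS0) T.P ∧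
      ∫ ω, c' (T.W ω) * (if T.S ω = 0 then (1 : ℝ) else 0) / T.pS0 ∂T.P =
        ∑ w, T.pWS0 w * c' w := by
    intro c'
    obtain ⟨i1, j1⟩ := tm_fiber T.P T.W {ω | T.S ω = 0} (fun _ => (1 : ℝ))
      (fun k => c' k / T.pS0) (integrable_const _) hm
      (fun ω => c' (T.W ω) * (if T.S ω = 0 then (1 : ℝ) else 0) / T.pS0)
      (by
        intro ω hω
        have hω' : T.S ω = 0 := hω
        simp only [if_pos hω', mul_one])
      (by
        intro ω hω
        have hω' : ¬ (T.S ω = 0) := hω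
        simp only [if_neg hω']
        simp)
    refine ⟨i1, ?_⟩
    rw [j1]
    refine Finset.sum_congr rfl fun w _ => ?_
    rw [tm_int1]
    have e : T.pWS0 w = T.pr {ω | T.W ω = w ∧ ω ∈ {ω | T.S ω = 0}} / T.pS0 := rfl
    rw [e]
    ring
  have h1 : ∑ w, T.pWS0 w = 1 := by
    have h := (key fun _ => 1).2
    simp only [one_mul, mul_one] at h
    rw [← h, integral_div]
    have e : (fun ω => if T.S ω = 0 then (1 : ℝ) else 0) =
        Set.indicator {ω | T.S ω = 0} (fun _ => 1) := by
      funext ω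
      simp [Set.indicator_apply]
    rw [e, integral_indicator (mS 0), tm_int1]
    exact div_self hp.ne'
  obtain ⟨i, j⟩ := key (fun w => r w - c)
  refine ⟨i, ?_⟩
  rw [j]
  simp only [mul_sub, Finset.sum_sub_distrib, ← Finset.sum_mul, h1]
  rw [← hc]
  ring

end TransportSetup

/-- Double robustness in the nuisance weights: for an arbitrary
(possibly misspecified) outcome regression `Q̄`, the one-step estimating-equation
functional built from the correctly specified transport-mediation weight `H` and the
true conditional probabilities is exactly unbiased: `Ψ̄ + E_P[D̄] = Ψ(P)`. -/
theorem double_robustness_in_nuisance_weights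
    {Ω : Type*} [MeasurableSpace Ω]
    {𝒲 : Type*} [MeasurableSpace 𝒲] [MeasurableSingletonClass 𝒲]
    [Fintype 𝒲] [Nonempty 𝒲]
    (T : TransportSetup Ω 𝒲) (a : Fin 2)
    (gs : Fin 2 → 𝒲 → ℝ)
    (hgs_pos : ∀ (m : Fin 2) (w : 𝒲), 0 < gs m w ∧ gs m w < 1)
    (hgs_sum : ∀ w : 𝒲, gs 0 w + gs 1 w = 1)
    -- an arbitrary (possibly misspecified) outcome regression
    (Qb : Fin 2 → Fin 2 → Fin 2 → 𝒲 → ℝ)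
    -- plug-in second-stage quantities
    (QbM : Fin 2 → Fin 2 → 𝒲 → ℝ)
    (hQbM : QbM = fun z x w => ∑ m : Fin 2, gs m w * Qb m z x w)
    (QbZ : 𝒲 → ℝ) (hQbZ : QbZ = fun w => ∑ z : Fin 2, T.pZ a z w 0 * QbM z a w)
    (Psib : ℝ) (hPsib : Psib = ∑ w : 𝒲, T.pWS0 w * QbZ w)
    -- the plug-in influence function
    (Db : Ω → ℝ)
    (hDb : Db = fun ω =>
      (T.Y ω - Qb (T.M ω) (T.Z ω) (T.A ω) (T.W ω)) * T.Hwt gs a ω +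
      (QbM (T.Z ω) a (T.W ω) - QbZ (T.W ω)) *
        (if T.S ω = 0 ∧ T.A ω = a then (1 : ℝ) else 0) / (T.pA a (T.W ω) 0 * T.pS0) +
      (QbZ (T.W ω) - Psib) * (if T.S ω = 0 then (1 : ℝ) else 0) / T.pS0) :
    Psib + (∫ ω, Db ω ∂T.P) = T.Psi gs a := by
  obtain ⟨i1, j1⟩ := T.tm_term1 a gs Qb
  obtain ⟨i2, j2⟩ := T.tm_term2 a (fun z w => QbM z a w) QbZ (fun w => by rw [hQbZ])
  obtain ⟨i3, j3⟩ := T.tm_term3 QbZ Psib hPsib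
  have hP : Psib = ∑ w : 𝒲, ∑ z : Fin 2, ∑ m : Fin 2,
        T.pWS0 w * T.pZ a z w 0 * gs m w * Qb m z a w := by
    rw [hPsib, hQbZ, hQbM]
    simp only [Finset.mul_sum, mul_assoc]
  have hI : ∫ ω, Db ω ∂T.P = T.Psi gs a - Psib := by
    rw [hDb]
    refine (integral_add (i1.add i2) i3).trans ?_
    rw [j3, integral_add' i1 i2, j1, j2, ← hP]
    ring
  rw [hI]
  ring
end
end

section
/- Double robustness in the outcome and second-stage regressions: let Q̄_Y(m,z,x,w) := E[Y | M=m, Z=z, A=x, W=w, S=1] be the true outcome regression, Q̄_M(z,x,w) := Σ_{m∈{0,1}} g*(m|w)·Q̄_Y(m,z,x,w), Q̄_Z(w) := Σ_{z∈{0,1}} P(Z=z | A=a, W=w, S=0)·Q̄_M(z,a,w) (the true second-stage regression), and Ψ̄ := Σ_{w∈𝒲} P(W=w | S=0)·Q̄_Z(w). Let K : {0,1}×{0,1}×{0,1}×𝒲 → ℝ be an arbitrary function (arbitrary, possibly misspecified weights), r : 𝒲 → (0,∞) an arbitrary strictly positive function, and c₁, c₂ > 0 arbitrary constants, and define D̃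 := (Y − Q̄_Y(M,Z,A,W))·K(M,Z,A,W)·1{S=1, A=a} + (Q̄_M(Z,a,W) − Q̄_Z(W))·1{S=0, A=a}/(r(W)·c₁) + (Q̄_Z(W) − Ψ̄)·1{S=0}/c₂. Then Ψ̄ = Ψ(P) and E_P[D̃] = 0, hence Ψ̄ + E_P[D̃] = Ψ(P): if the outcome regression and the second-stage regression are correctly specified, the estimating-equation functional recovers the transported estimand no matter how the mediator, intermediate-variable, treatment, and site models are specified. -/
open MeasureTheory

noncomputable section

theorem aux_cells {Ω ι : Type*} [MeasurableSpace Ω] [MeasurableSpace ι]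
    [MeasurableSingletonClass ι] [Fintype ι] (μ : Measure Ω) (V : Ω → ι) (hV : Measurable V)
    (X : Ω → ℝ) (hX : Integrable X μ) (h : ∀ v, ∫ ω in V ⁻¹' {v}, X ω ∂μ = 0) :
    ∫ ω, X ω ∂μ = 0 := by
  have h1 := integral_iUnion_fintype (μ := μ) (f := X) (s := fun v => V ⁻¹' {v})
    (fun v => hV (measurableSet_singleton v))
    (fun i j hij => Disjoint.preimage V (by simpa using hij))
    (fun v => hX.integrableOn)
  have h2 : (⋃ v, V ⁻¹' {v}) = Set.univ := by ext; simp
  rw [h2, Measure.restrict_univ] at h1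
  rw [h1]
  exact Finset.sum_eq_zero fun v _ => h v

theorem aux_center {Ω : Type*} [MeasurableSpace Ω] (μ : Measure Ω) [IsFiniteMeasure μ]
    (F : Set Ω) (f : Ω → ℝ) (hf : Integrable f μ) (c : ℝ)
    (hc : c = (∫ ω in F, f ω ∂μ) / (μ F).toReal) :
    ∫ ω in F, (f ω - c) ∂μ = 0 := by
  rw [integral_sub hf.integrableOn (integrable_const c)]
  rw [setIntegral_const, Measure.real, smul_eq_mul]
  by_cases h0 : (μ F).toReal = 0
  · have : μ F = 0 := by
      rcases (ENNReal.toReal_eq_zero_iff _).1 h0 with h | h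
      · exact h
      · exact absurd h (measure_ne_top μ F)
    rw [h0, setIntegral_measure_zero _ this]; simp
  · rw [hc]; field_simp; simp

theorem aux_sum {Ω ι : Type*} [MeasurableSpace Ω] [MeasurableSpace ι]
    [MeasurableSingletonClass ι] [Fintype ι] (μ : Measure Ω) [IsFiniteMeasure μ]
    (V : Ω → ι) (hV : Measurable V) (F : Set Ω) (h : ι → ℝ) :
    ∫ ω in F, h (V ω) ∂μ = ∑ v, (μ ({ω | V ω = v} ∩ F)).toReal * h v := by
  rw [← integral_map (μ := μ.restrict F) (φ := V) (f := h) hV.aemeasurable .of_discrete,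
    integral_fintype .of_finite]
  refine Finset.sum_congr rfl fun v _ => ?_
  rw [Measure.real, Measure.map_apply hV (measurableSet_singleton v),
    Measure.restrict_apply (hV (measurableSet_singleton v)), smul_eq_mul]
  rfl

theorem aux_int {Ω ι : Type*} [MeasurableSpace Ω] [MeasurableSpace ι]
    [MeasurableSingletonClass ι] [Finite ι] (μ : Measure Ω) [IsFiniteMeasure μ]
    (V : Ω → ι) (hV : Measurable V) (h : ι → ℝ) : Integrable (fun ω => h (V ω)) μ :=
  (Integrable.of_finite (μ := μ.map V) (f := h)).comp_measurable hV

/-- Double robustness in the outcome and second-stage regressions: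
with the true outcome regression `Q̄_Y` and true second-stage regression `Q̄_Z`, the
estimating-equation functional recovers the transported estimand no matter how the
mediator, intermediate-variable, treatment, and site models are specified:
`Ψ̄ = Ψ(P)`, `E_P[D̃] = 0`, hence `Ψ̄ + E_P[D̃] = Ψ(P)`. -/
theorem double_robustness_in_outcome_regressions
    {Ω : Type*} [MeasurableSpace Ω]
    {𝒲 : Type*} [MeasurableSpace 𝒲] [MeasurableSingletonClass 𝒲]
    [Fintype 𝒲] [Nonempty 𝒲]
    (T : TransportSetup Ω 𝒲) (a : Fin 2)
    (gs : Fin 2 → 𝒲 → ℝ)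
    (hgs_pos : ∀ (m : Fin 2) (w : 𝒲), 0 < gs m w ∧ gs m w < 1)
    (hgs_sum : ∀ w : 𝒲, gs 0 w + gs 1 w = 1)
    -- arbitrary, possibly misspecified weights
    (K : Fin 2 → Fin 2 → Fin 2 → 𝒲 → ℝ)
    (r : 𝒲 → ℝ) (hr : ∀ w, 0 < r w)
    (c₁ c₂ : ℝ) (hc₁ : 0 < c₁) (hc₂ : 0 < c₂)
    -- the plug-in estimand built from the true second-stage regression
    (Psib : ℝ) (hPsib : Psib = ∑ w : 𝒲, T.pWS0 w * T.qbarZ gs a w)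
    -- the estimating-equation influence function with misspecified weights
    (Dt : Ω → ℝ)
    (hDt : Dt = fun ω =>
      (T.Y ω - T.qbarY (T.M ω) (T.Z ω) (T.A ω) (T.W ω)) *
        K (T.M ω) (T.Z ω) (T.A ω) (T.W ω) *
        (if T.S ω = 1 ∧ T.A ω = a then (1 : ℝ) else 0) +
      (T.qbarM gs (T.Z ω) a (T.W ω) - T.qbarZ gs a (T.W ω)) *
        (if T.S ω = 0 ∧ T.A ω = a then (1 : ℝ) else 0) / (r (T.W ω) * c₁) +
      (T.qbarZ gs a (T.W ω) - Psib) * (if T.S ω = 0 then (1 : ℝ) else 0) / c₂) :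
    Psib = T.Psi gs a ∧
    (∫ ω, Dt ω ∂T.P) = 0 ∧
    Psib + (∫ ω, Dt ω ∂T.P) = T.Psi gs a := by
  have := T.isProb
  have hP : Psib = T.Psi gs a := by
    rw [hPsib]
    simp only [TransportSetup.Psi, TransportSetup.qbarZ, TransportSetup.qbarM, Finset.mul_sum]
    refine Finset.sum_congr rfl fun w _ => Finset.sum_congr rfl fun z _ =>
      Finset.sum_congr rfl fun m _ => ?_
    ring
  have mM := T.measM
  have mZ := T.measZ
  have mA := T.measA
  have mW := T.measW
  have mS := T.measS
  -- integrability
  obtain ⟨C, hC⟩ : ∃ C, ∀ y ∈ T.ySet, ‖y‖ ≤ C := by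
    obtain ⟨C, hC⟩ := (T.ySet.finite_toSet.image (fun y => ‖y‖)).bddAbove
    exact ⟨C, fun y hy => hC ⟨y, hy, rfl⟩⟩
  have iY : Integrable T.Y T.P :=
    Integrable.of_bound T.measY.aestronglyMeasurable C (ae_of_all _ fun ω => hC _ (T.hY ω))
  let V : Ω → Fin 2 × Fin 2 × Fin 2 × 𝒲 × Fin 2 :=
    fun ω => (T.M ω, T.Z ω, T.A ω, T.W ω, T.S ω)
  have hV : Measurable V := by fun_prop
  have iQ : Integrable (fun ω => T.qbarY (T.M ω) (T.Z ω) (T.A ω) (T.W ω)) T.P :=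
    aux_int T.P V hV (fun v => T.qbarY v.1 v.2.1 v.2.2.1 v.2.2.2.1)
  have i1 : Integrable (fun ω => (T.Y ω - T.qbarY (T.M ω) (T.Z ω) (T.A ω) (T.W ω)) *
        K (T.M ω) (T.Z ω) (T.A ω) (T.W ω) *
        (if T.S ω = 1 ∧ T.A ω = a then (1 : ℝ) else 0)) T.P := by
    let k : Fin 2 × Fin 2 × Fin 2 × 𝒲 × Fin 2 → ℝ := fun v =>
      K v.1 v.2.1 v.2.2.1 v.2.2.2.1 *
        (if v.2.2.2.2 = 1 ∧ v.2.2.1 = a then (1 : ℝ) else 0)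
    obtain ⟨B, hB⟩ := (Set.finite_range (fun v => ‖k v‖)).bddAbove
    have := (iY.sub iQ).mul_bdd (g := fun ω => k (V ω)) (c := B)
      (aux_int T.P V hV k).aestronglyMeasurable
      (ae_of_all _ fun ω => hB ⟨V ω, rfl⟩)
    refine this.congr (ae_of_all _ fun ω => ?_)
    simp only [k, V, Pi.sub_apply, mul_assoc]
  have i2 : Integrable (fun ω => (T.qbarM gs (T.Z ω) a (T.W ω) - T.qbarZ gs a (T.W ω)) *
        (if T.S ω = 0 ∧ T.A ω = a then (1 : ℝ) else 0) / (r (T.W ω) * c₁)) T.P :=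
    aux_int T.P V hV (fun v => (T.qbarM gs v.2.1 a v.2.2.2.1 - T.qbarZ gs a v.2.2.2.1) *
        (if v.2.2.2.2 = 0 ∧ v.2.2.1 = a then (1 : ℝ) else 0) / (r v.2.2.2.1 * c₁))
  have i3 : Integrable (fun ω => (T.qbarZ gs a (T.W ω) - Psib) *
      (if T.S ω = 0 then (1 : ℝ) else 0) / c₂) T.P :=
    aux_int T.P V hV (fun v => (T.qbarZ gs a v.2.2.2.1 - Psib) *
        (if v.2.2.2.2 = 0 then (1 : ℝ) else 0) / c₂)
  have e1 : ∫ ω, (T.Y ω - T.qbarY (T.M ω) (T.Z ω) (T.A ω) (T.W ω)) *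
        K (T.M ω) (T.Z ω) (T.A ω) (T.W ω) *
        (if T.S ω = 1 ∧ T.A ω = a then (1 : ℝ) else 0) ∂T.P = 0 := by
    refine aux_cells T.P V hV _ i1 ?_
    rintro ⟨m, z, x, w, s⟩
    have hm : MeasurableSet (V ⁻¹' {(m, z, x, w, s)}) := hV (measurableSet_singleton _)
    have hcong : ∫ ω in V ⁻¹' {(m, z, x, w, s)},
        (T.Y ω - T.qbarY (T.M ω) (T.Z ω) (T.A ω) (T.W ω)) *
        K (T.M ω) (T.Z ω) (T.A ω) (T.W ω) *
        (if T.S ω = 1 ∧ T.A ω = a then (1 : ℝ) else 0) ∂T.P =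
        ∫ ω in V ⁻¹' {(m, z, x, w, s)}, (T.Y ω - T.qbarY m z x w) *
        (K m z x w * (if s = 1 ∧ x = a then (1 : ℝ) else 0)) ∂T.P := by
      refine setIntegral_congr_fun hm fun ω hω => ?_
      simp only [V, Set.mem_preimage, Set.mem_singleton_iff, Prod.mk.injEq] at hω
      obtain ⟨rfl, rfl, rfl, rfl, rfl⟩ := hω
      simp only [mul_assoc]
    rw [hcong, integral_mul_const]
    by_cases hs : s = 1
    · subst hs
      have hF : V ⁻¹' {(m, z, x, w, 1)} =
          {ω | T.M ω = m ∧ T.Z ω = z ∧ T.A ω = x ∧ T.W ω = w ∧ T.S ω = 1} := by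
        ext ω; simp [V]
      rw [hF, aux_center T.P _ T.Y iY (T.qbarY m z x w) rfl, zero_mul]
    · simp [hs]
  have e2 : ∫ ω, (T.qbarM gs (T.Z ω) a (T.W ω) - T.qbarZ gs a (T.W ω)) *
        (if T.S ω = 0 ∧ T.A ω = a then (1 : ℝ) else 0) / (r (T.W ω) * c₁) ∂T.P = 0 := by
    let U : Ω → Fin 2 × 𝒲 × Fin 2 := fun ω => (T.A ω, T.W ω, T.S ω)
    have hU : Measurable U := by fun_prop
    refine aux_cells T.P U hU _ i2 ?_
    rintro ⟨x, w, s⟩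
    have hm : MeasurableSet (U ⁻¹' {(x, w, s)}) := hU (measurableSet_singleton _)
    have hcong : ∫ ω in U ⁻¹' {(x, w, s)},
        (T.qbarM gs (T.Z ω) a (T.W ω) - T.qbarZ gs a (T.W ω)) *
        (if T.S ω = 0 ∧ T.A ω = a then (1 : ℝ) else 0) / (r (T.W ω) * c₁) ∂T.P =
        ∫ ω in U ⁻¹' {(x, w, s)}, (T.qbarM gs (T.Z ω) a w - T.qbarZ gs a w) *
        ((if s = 0 ∧ x = a then (1 : ℝ) else 0) / (r w * c₁)) ∂T.P := by
      refine setIntegral_congr_fun hm fun ω hω => ?_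
      simp only [U, Set.mem_preimage, Set.mem_singleton_iff, Prod.mk.injEq] at hω
      obtain ⟨rfl, rfl, rfl⟩ := hω
      simp only [mul_div_assoc]
    rw [hcong, integral_mul_const]
    by_cases hs : s = 0 ∧ x = a
    · obtain ⟨rfl, rfl⟩ := hs
      have hF : U ⁻¹' {(x, w, 0)} = {ω | T.A ω = x ∧ T.W ω = w ∧ T.S ω = 0} := by
        ext ω; simp [U]
      rw [hF, aux_center T.P _ (fun ω => T.qbarM gs (T.Z ω) x w)
        (aux_int T.P T.Z mZ fun z => T.qbarM gs z x w) (T.qbarZ gs x w), zero_mul]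
      rw [aux_sum T.P T.Z mZ _ (fun z => T.qbarM gs z x w), Finset.sum_div]
      refine Finset.sum_congr rfl fun z _ => ?_
      simp only [TransportSetup.pZ, TransportSetup.cpr, TransportSetup.pr]
      ring
    · simp [hs]
  have e3 : ∫ ω, (T.qbarZ gs a (T.W ω) - Psib) *
      (if T.S ω = 0 then (1 : ℝ) else 0) / c₂ ∂T.P = 0 := by
    refine aux_cells T.P T.S mS _ i3 ?_
    intro s
    have hm : MeasurableSet (T.S ⁻¹' {s}) := mS (measurableSet_singleton _)
    have hcong : ∫ ω in T.S ⁻¹' {s}, (T.qbarZ gs a (T.W ω) - Psib) *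
        (if T.S ω = 0 then (1 : ℝ) else 0) / c₂ ∂T.P =
        ∫ ω in T.S ⁻¹' {s}, (T.qbarZ gs a (T.W ω) - Psib) *
        ((if s = 0 then (1 : ℝ) else 0) / c₂) ∂T.P := by
      refine setIntegral_congr_fun hm fun ω hω => ?_
      simp only [Set.mem_preimage, Set.mem_singleton_iff] at hω
      obtain rfl := hω
      simp only [mul_div_assoc]
    rw [hcong, integral_mul_const]
    by_cases hs : s = 0
    · subst hs
      have hF : T.S ⁻¹' {0} = {ω | T.S ω = 0} := by
        ext ω; simp
      rw [hF, aux_center T.P _ (fun ω => T.qbarZ gs a (T.W ω))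
        (aux_int T.P T.W mW fun w => T.qbarZ gs a w) Psib, zero_mul]
      rw [aux_sum T.P T.W mW _ (fun w => T.qbarZ gs a w), Finset.sum_div, hPsib]
      refine Finset.sum_congr rfl fun w _ => ?_
      simp only [TransportSetup.pWS0, TransportSetup.cpr, TransportSetup.pr]
      ring
    · simp [hs]
  have hD : ∫ ω, Dt ω ∂T.P = 0 := by
    have h12 := integral_add i1 i2
    have h123 := integral_add (i1.add i2) i3
    rw [hDt]
    refine h123.trans ?_
    rw [e3, add_zero]
    refine h12.trans ?_
    rw [e1, e2, add_zero]
  exact ⟨hP, hD, by rw [hD, add_zero, hP]⟩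
end
end
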